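/- Every normalized unconditional basis of the Banach space ℓ₁ ⊕ c₀ is permutatively equivalent to the canonical basis of ℓ₁ ⊕ c₀, i.e., to the direct sum of the unit vector bases of ℓ₁ and c₀. (This is the instance A = {1,∞} of the paper's uniqueness theorem, with the convention that ℓ_∞ means c₀.) -/

import Mathlib

open scoped ENNReal ZeroAtInfty

noncomputable section

/-- The closed linear span of a family of vectors. -/
def closedSpan {X : Type*} [NormedAddCommGroup X] [NormedSpace ℝ X]
    {J : Type*} (x : J → X) : Submodule ℝ X :=
  (Submodule.span ℝ (Set.range x)).topologicalClosure

theorem mem_closedSpan {X : Type*} [NormedAddCommGroup X] [NormedSpace ℝ X]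
    {J : Type*} (x : J → X) (j : J) : x j ∈ closedSpan x :=
  Submodule.le_topologicalClosure _ (Submodule.subset_span ⟨j, rfl⟩)

/-- Two families of vectors are permutatively equivalent if some bijection of the index sets
is implemented by a linear homeomorphism between their closed linear spans. -/
def PermutativelyEquivalent {X Y : Type*} [NormedAddCommGroup X] [NormedSpace ℝ X]
    [NormedAddCommGroup Y] [NormedSpace ℝ Y]
    {J I : Type*} (x : J → X) (y : I → Y) : Prop :=
  ∃ (π : J ≃ I) (T : closedSpan x ≃L[ℝ] closedSpan y),
    ∀ j : J, (T ⟨x j, mem_closedSpan x j⟩ : Y) = y (π j)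

/-- The `n`-th unit vector of `c₀`. -/
def c0single (n : ℕ) : C₀(ℕ, ℝ) :=
  ⟨⟨fun k => if k = n then 1 else 0, continuous_of_discreteTopology⟩, by
    have h : ∀ᶠ k in Filter.cocompact ℕ, (0 : ℝ) = if k = n then (1 : ℝ) else 0 := by
      rw [Filter.cocompact_eq_cofinite, Nat.cofinite_eq_atTop]
      filter_upwards [Filter.eventually_gt_atTop n] with k hk
      rw [if_neg (by omega)]
    exact Filter.Tendsto.congr' h tendsto_const_nhds⟩

/-- The canonical basis of `ℓ₁ ⊕ c₀`: unit vectors of `ℓ₁` in the first coordinate together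
with unit vectors of `c₀` in the second coordinate. -/
def canBasisL1C0 : ℕ ⊕ ℕ → (lp (fun _ : ℕ => ℝ) 1) × C₀(ℕ, ℝ) :=
  Sum.elim (fun n => (lp.single 1 n (1 : ℝ), 0)) (fun n => (0, c0single n))

open Classical in
def sgnOf {ι : Type*} (s : Finset ι) (j : ι) : ℝ := if j ∈ s then 1 else -1

open Classical in
lemma sum_sgn_insert {ι : Type*} (F : Finset ι) (i : ι) (hi : i ∉ F) (a : ι → ℝ) (φ : ℝ → ℝ) :
    ∑ s ∈ (insert i F).powerset, φ (∑ j ∈ insert i F, sgnOf s j * a j) =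
      ∑ s ∈ F.powerset, (φ (∑ j ∈ F, sgnOf s j * a j - a i) +
        φ (∑ j ∈ F, sgnOf s j * a j + a i)) := by
  rw [Finset.sum_powerset_insert hi, ← Finset.sum_add_distrib]
  refine Finset.sum_congr rfl fun s hs => ?_
  have his : i ∉ s := fun h => hi (Finset.mem_powerset.1 hs h)
  rw [Finset.sum_insert hi, Finset.sum_insert hi]
  have h1 : ∑ j ∈ F, sgnOf (insert i s) j * a j = ∑ j ∈ F, sgnOf s j * a j := by
    refine Finset.sum_congr rfl fun j hj => ?_
    have : j ≠ i := fun h => hi (h ▸ hj)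
    simp [sgnOf, this]
  rw [h1]
  have h2 : sgnOf s i = -1 := by simp [sgnOf, his]
  have h3 : sgnOf (insert i s) i = 1 := by simp [sgnOf]
  rw [h2, h3]
  congr 2 <;> ring

lemma moment2 {ι : Type*} (F : Finset ι) (a : ι → ℝ) :
    ∑ s ∈ F.powerset, (∑ j ∈ F, sgnOf s j * a j) ^ 2 = 2 ^ F.card * ∑ j ∈ F, a j ^ 2 := by
  classical
  induction F using Finset.induction_on with
  | empty => simp
  | insert i F hi ih =>
    rw [sum_sgn_insert F i hi a (fun t => t ^ 2), Finset.card_insert_of_notMem hi,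
      Finset.sum_insert hi]
    have : ∀ s ∈ F.powerset, ((∑ j ∈ F, sgnOf s j * a j - a i) ^ 2 +
        (∑ j ∈ F, sgnOf s j * a j + a i) ^ 2) =
        2 * (∑ j ∈ F, sgnOf s j * a j) ^ 2 + 2 * a i ^ 2 := fun s _ => by ring
    rw [Finset.sum_congr rfl this, Finset.sum_add_distrib, ← Finset.mul_sum, ih]
    simp only [Finset.sum_const, Finset.card_powerset, nsmul_eq_mul]
    push_cast
    ring

lemma moment4 {ι : Type*} (F : Finset ι) (a : ι → ℝ) :
    ∑ s ∈ F.powerset, (∑ j ∈ F, sgnOf s j * a j) ^ 4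
      ≤ 3 * 2 ^ F.card * (∑ j ∈ F, a j ^ 2) ^ 2 := by
  classical
  induction F using Finset.induction_on with
  | empty => simp
  | insert i F hi ih =>
    rw [sum_sgn_insert F i hi a (fun t => t ^ 4), Finset.card_insert_of_notMem hi,
      Finset.sum_insert hi]
    have : ∀ s ∈ F.powerset, ((∑ j ∈ F, sgnOf s j * a j - a i) ^ 4 +
        (∑ j ∈ F, sgnOf s j * a j + a i) ^ 4) =
        2 * (∑ j ∈ F, sgnOf s j * a j) ^ 4
          + 12 * a i ^ 2 * (∑ j ∈ F, sgnOf s j * a j) ^ 2 + 2 * a i ^ 4 := fun s _ => by ring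
    rw [Finset.sum_congr rfl this, Finset.sum_add_distrib, Finset.sum_add_distrib,
      ← Finset.mul_sum, ← Finset.mul_sum, moment2]
    simp only [Finset.sum_const, Finset.card_powerset, nsmul_eq_mul]
    push_cast
    have h2 : (0:ℝ) ≤ 2 ^ F.card * a i ^ 4 := by positivity
    rw [pow_succ (2:ℝ) F.card]
    nlinarith

lemma khinchine {ι : Type*} (F : Finset ι) (a : ι → ℝ) :
    2 ^ F.card * √(∑ j ∈ F, a j ^ 2) ≤
      2 * ∑ s ∈ F.powerset, |∑ j ∈ F, sgnOf s j * a j| := by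
  set σ := √(∑ j ∈ F, a j ^ 2) with hσ
  have hσ2 : σ ^ 2 = ∑ j ∈ F, a j ^ 2 := Real.sq_sqrt (Finset.sum_nonneg fun _ _ => sq_nonneg _)
  have hσ0 : 0 ≤ σ := Real.sqrt_nonneg _
  rcases hσ0.eq_or_lt with h0 | hpos
  · rw [← h0]
    have : 0 ≤ ∑ s ∈ F.powerset, |∑ j ∈ F, sgnOf s j * a j| :=
      Finset.sum_nonneg fun _ _ => abs_nonneg _
    linarith
  have key : ∀ t : ℝ, σ ^ 2 * t ^ 2 - 4 / 27 * t ^ 4 ≤ σ ^ 3 * |t| := by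
    intro t
    have h1 : t ^ 2 = |t| ^ 2 := (sq_abs t).symm
    have h2 : t ^ 4 = |t| ^ 4 := by rw [show (4:ℕ) = 2 * 2 from rfl, pow_mul, pow_mul, h1]
    rw [h1, h2]
    have h3 : 0 ≤ 4 / 27 * |t| * ((|t| - 3 / 2 * σ) ^ 2 * (|t| + 3 * σ)) := by positivity
    nlinarith
  have hsum := Finset.sum_le_sum (s := F.powerset) fun s _ => key (∑ j ∈ F, sgnOf s j * a j)
  rw [Finset.sum_sub_distrib, ← Finset.mul_sum, ← Finset.mul_sum, ← Finset.mul_sum, moment2,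
    ← hσ2] at hsum
  have h4 := moment4 F a
  rw [← hσ2] at h4
  have h5 : σ ^ 3 * (2 ^ F.card * σ) ≤
      σ ^ 3 * (2 * ∑ s ∈ F.powerset, |∑ j ∈ F, sgnOf s j * a j|) := by
    have : (0:ℝ) ≤ 2 ^ F.card * σ ^ 4 := by positivity
    nlinarith
  exact le_of_mul_le_mul_left h5 (by positivity)

lemma khinchine_l1 {ι κ : Type*} (F : Finset ι) (G : Finset κ) (m : ι → κ → ℝ) (C : ℝ)
    (h : ∀ s ⊆ F, ∑ n ∈ G, |∑ j ∈ F, sgnOf s j * m j n| ≤ C) :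
    ∑ n ∈ G, √(∑ j ∈ F, m j n ^ 2) ≤ 2 * C := by
  have h1 : 2 ^ F.card * ∑ n ∈ G, √(∑ j ∈ F, m j n ^ 2) ≤ 2 ^ F.card * (2 * C) := by
    calc _ = ∑ n ∈ G, 2 ^ F.card * √(∑ j ∈ F, m j n ^ 2) := Finset.mul_sum _ _ _
      _ ≤ ∑ n ∈ G, 2 * ∑ s ∈ F.powerset, |∑ j ∈ F, sgnOf s j * m j n| :=
        Finset.sum_le_sum fun n _ => khinchine F fun j => m j n
      _ = 2 * ∑ s ∈ F.powerset, ∑ n ∈ G, |∑ j ∈ F, sgnOf s j * m j n| := by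
        rw [← Finset.mul_sum, Finset.sum_comm]
      _ ≤ 2 * ∑ s ∈ F.powerset, C := by
        gcongr with s hs
        exact h s (Finset.mem_powerset.1 hs)
      _ = _ := by
        simp only [Finset.sum_const, Finset.card_powerset, nsmul_eq_mul]
        push_cast; ring
  exact le_of_mul_le_mul_left h1 (by positivity)

lemma cs_abs {ι : Type*} (F : Finset ι) (a b : ι → ℝ) :
    ∑ j ∈ F, |a j * b j| ≤ √(∑ j ∈ F, a j ^ 2) * √(∑ j ∈ F, b j ^ 2) := by
  have := Real.sum_mul_le_sqrt_mul_sqrt F (fun j => |a j|) (fun j => |b j|)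
  simpa [abs_mul, sq_abs] using this

/-- The key finite-dimensional estimate. -/
lemma key_estimate {ι κ : Type*} (F : Finset ι) (G : Finset κ) (u b : ι → κ → ℝ)
    (N : (ι → ℝ) → ℝ) (M : ℝ) (hM : 0 < M)
    (h1 : ∀ c : ι → ℝ, ∀ s ⊆ F, ∑ n ∈ G, |∑ j ∈ F, sgnOf s j * (c j * u j n)| ≤ N c)
    (h2 : ∀ n ∈ G, N (fun j => b j n) ≤ M)
    (h2' : ∀ j ∈ F, ∀ n ∈ G, |b j n| ≤ M)
    (h3 : ∀ j ∈ F, 1 / 3 ≤ ∑ n ∈ G, u j n * b j n) (c : ι → ℝ) :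
    ∑ j ∈ F, |c j| ≤ 36 * M ^ 2 * N c := by
  have hk : ∀ c : ι → ℝ, ∑ n ∈ G, √(∑ j ∈ F, (c j * u j n) ^ 2) ≤ 2 * N c :=
    fun c => khinchine_l1 F G (fun j n => c j * u j n) _ (h1 c)
  have hu : ∀ j ∈ F, 1 / 3 ≤ M * ∑ n ∈ G, |u j n| := by
    intro j hj
    refine (h3 j hj).trans ?_
    rw [Finset.mul_sum]
    refine Finset.sum_le_sum fun n hn => ?_
    calc u j n * b j n ≤ |u j n * b j n| := le_abs_self _
      _ = |u j n| * |b j n| := abs_mul _ _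
      _ ≤ |u j n| * M := by gcongr; exact h2' j hj n hn
      _ = _ := mul_comm _ _
  have hb : ∀ n ∈ G, √(∑ j ∈ F, b j n ^ 2) ≤ 6 * M ^ 2 := by
    intro n hn
    set c : ι → ℝ := fun j => b j n with hc
    set τ := √(∑ j ∈ F, c j ^ 2) with hτ
    have hτ2 : τ ^ 2 = ∑ j ∈ F, c j ^ 2 :=
      Real.sq_sqrt (Finset.sum_nonneg fun _ _ => sq_nonneg _)
    have e1 : τ ^ 2 / 3 ≤ M * ∑ j ∈ F, c j ^ 2 * ∑ k ∈ G, |u j k| := by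
      rw [hτ2, Finset.sum_div, Finset.mul_sum]
      refine Finset.sum_le_sum fun j hj => ?_
      have := mul_le_mul_of_nonneg_left (hu j hj) (sq_nonneg (c j))
      linarith
    have e2 : ∑ j ∈ F, c j ^ 2 * ∑ k ∈ G, |u j k| =
        ∑ k ∈ G, ∑ j ∈ F, |c j * (c j * u j k)| := by
      rw [Finset.sum_comm]
      refine Finset.sum_congr rfl fun j _ => ?_
      rw [Finset.mul_sum]
      refine Finset.sum_congr rfl fun k _ => ?_
      rw [abs_mul, abs_mul, ← mul_assoc, ← sq, sq_abs]
    have e3 : ∑ k ∈ G, ∑ j ∈ F, |c j * (c j * u j k)| ≤ τ * (2 * M) := by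
      calc _ ≤ ∑ k ∈ G, τ * √(∑ j ∈ F, (c j * u j k) ^ 2) :=
            Finset.sum_le_sum fun k _ => cs_abs F c fun j => c j * u j k
        _ = τ * ∑ k ∈ G, √(∑ j ∈ F, (c j * u j k) ^ 2) := (Finset.mul_sum _ _ _).symm
        _ ≤ τ * (2 * M) := by
          gcongr
          exact (hk c).trans (by have := h2 n hn; linarith)
    have e4 : τ * τ ≤ τ * (6 * M ^ 2) := by
      rw [e2] at e1
      have := mul_le_mul_of_nonneg_left e3 hM.le
      nlinarith
    rcases (Real.sqrt_nonneg (∑ j ∈ F, c j ^ 2)).eq_or_lt with h0 | h0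
    · rw [← hτ] at h0; rw [← h0]; positivity
    · exact le_of_mul_le_mul_left e4 h0
  calc ∑ j ∈ F, |c j| ≤ ∑ j ∈ F, 3 * ∑ n ∈ G, |c j * u j n * b j n| := by
        refine Finset.sum_le_sum fun j hj => ?_
        have a1 : 1 / 3 ≤ ∑ n ∈ G, |u j n * b j n| :=
          (h3 j hj).trans (Finset.sum_le_sum fun n _ => le_abs_self _)
        have a2 : ∑ n ∈ G, |c j * u j n * b j n| = |c j| * ∑ n ∈ G, |u j n * b j n| := by
          rw [Finset.mul_sum]
          exact Finset.sum_congr rfl fun n _ => by rw [mul_assoc, abs_mul]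
        rw [a2]
        have := mul_le_mul_of_nonneg_left a1 (abs_nonneg (c j))
        linarith
    _ = 3 * ∑ n ∈ G, ∑ j ∈ F, |c j * u j n * b j n| := by
        rw [← Finset.mul_sum, Finset.sum_comm]
    _ ≤ 3 * ∑ n ∈ G, √(∑ j ∈ F, (c j * u j n) ^ 2) * (6 * M ^ 2) := by
        gcongr with n hn
        refine (cs_abs F (fun j => c j * u j n) (fun j => b j n)).trans ?_
        gcongr
        exact hb n hn
    _ = 18 * M ^ 2 * ∑ n ∈ G, √(∑ j ∈ F, (c j * u j n) ^ 2) := by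
        rw [← Finset.sum_mul]; ring
    _ ≤ 18 * M ^ 2 * (2 * N c) := by gcongr; exact hk c
    _ = _ := by ring

lemma no_c0_in_l1 {J : Type*} (m : ℕ → J → ℝ) (C δ : ℝ) (hδ : 0 < δ)
    (h : ∀ (F : Finset J) (G : Finset ℕ), ∀ s ⊆ G, ∑ j ∈ F, |∑ n ∈ G, sgnOf s n * m n j| ≤ C)
    (hm : ∀ n, ∃ F : Finset J, δ ≤ ∑ j ∈ F, |m n j|) : False := by
  classical
  choose Φ hΦ using hm
  have key : ∀ k : ℕ, k * δ ≤ √k * (2 * C) := by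
    intro k
    set G := Finset.range k
    set F := G.biUnion Φ
    have := khinchine_l1 G F m C (h F G)
    calc k * δ = ∑ n ∈ G, δ := by simp [G]
      _ ≤ ∑ n ∈ G, ∑ j ∈ F, |m n j| := by
        refine Finset.sum_le_sum fun n hn => (hΦ n).trans ?_
        exact Finset.sum_le_sum_of_subset_of_nonneg (Finset.subset_biUnion_of_mem Φ hn)
          fun _ _ _ => abs_nonneg _
      _ = ∑ j ∈ F, ∑ n ∈ G, |1 * m n j| := by rw [Finset.sum_comm]; simp
      _ ≤ ∑ j ∈ F, √k * √(∑ n ∈ G, m n j ^ 2) := by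
        refine Finset.sum_le_sum fun j _ => ?_
        have := cs_abs G (fun _ => 1) (fun n => m n j)
        simpa [G] using this
      _ = √k * ∑ j ∈ F, √(∑ n ∈ G, m n j ^ 2) := (Finset.mul_sum _ _ _).symm
      _ ≤ _ := by gcongr
  obtain ⟨k, hk⟩ := exists_nat_gt (2 * |C| / δ)
  have h1 := key ((k + 1) ^ 2)
  push_cast at h1
  rw [Real.sqrt_sq (by positivity)] at h1
  rw [div_lt_iff₀ hδ] at hk
  have h2 : ((k:ℝ) + 1) * (((k:ℝ) + 1) * δ) ≤ (k + 1) * (2 * C) := by linarith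
  have h3 := le_of_mul_le_mul_left h2 (by positivity)
  have := le_abs_self C
  linarith

lemma bdd_finset_sums {X : Type*} [NormedAddCommGroup X] {J : Type*} {g : J → X}
    (hg : Summable g) : ∃ C, ∀ F : Finset J, ‖∑ j ∈ F, g j‖ ≤ C := by
  classical
  obtain ⟨s, hs⟩ := cauchySeq_finset_iff_vanishing_norm.1 hg.hasSum.cauchySeq 1 one_pos
  refine ⟨∑ j ∈ s, ‖g j‖ + 1, fun F => ?_⟩
  rw [← Finset.sum_inter_add_sum_sdiff F s]
  refine (norm_add_le _ _).trans (add_le_add ?_ ?_)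
  · refine (norm_sum_le _ _).trans ?_
    exact Finset.sum_le_sum_of_subset_of_nonneg Finset.inter_subset_right
      fun _ _ _ => norm_nonneg _
  · exact (hs _ Finset.sdiff_disjoint).le

lemma basis_coords {X : Type*} [NormedAddCommGroup X] [NormedSpace ℝ X] [CompleteSpace X]
    {J : Type*} (x : J → X) (hnorm : ∀ j, ‖x j‖ = 1)
    (hbasis : ∀ f : X, ∃! a : J → ℝ, HasSum (fun j => a j • x j) f) :
    ∃ (φ : J → X →L[ℝ] ℝ) (K : ℝ), 1 ≤ K ∧ (∀ f, HasSum (fun j => φ j f • x j) f) ∧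
      (∀ (f : X) (a : J → ℝ), HasSum (fun j => a j • x j) f → ∀ j, a j = φ j f) ∧
      ∀ (F : Finset J) f, ‖∑ j ∈ F, φ j f • x j‖ ≤ K * ‖f‖ := by
  choose a ha huniq using fun f => (hbasis f)
  simp only at ha
  have hadd : ∀ f g, a (f + g) = a f + a g := fun f g => by
    refine (huniq (f + g) _ ?_).symm
    simpa [add_smul] using (ha f).add (ha g)
  have hsmul : ∀ (r : ℝ) f, a (r • f) = r • a f := fun r f => by
    refine (huniq (r • f) _ ?_).symm
    simpa [mul_smul] using (ha f).const_smul r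
  let S : X →ₗ[ℝ] lp (fun _ : Finset J => X) ∞ :=
    { toFun := fun f => ⟨fun F => ∑ j ∈ F, a f j • x j, by
        obtain ⟨C, hC⟩ := bdd_finset_sums (ha f).summable
        refine memℓp_infty ⟨C, ?_⟩
        rintro _ ⟨F, rfl⟩
        exact hC F⟩
      map_add' := fun f g => by
        ext F
        simp only [hadd, Pi.add_apply, add_smul, Finset.sum_add_distrib]
        rfl
      map_smul' := fun r f => by
        ext F
        simp only [hsmul, Pi.smul_apply, smul_eq_mul, mul_smul, ← Finset.smul_sum]
        rfl }
  have hS : ∀ f F, (S f : ∀ _ : Finset J, X) F = ∑ j ∈ F, a f j • x j := fun _ _ => rfl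
  have hScont : Continuous S := by
    refine S.continuous_of_seq_closed_graph fun u f ψ hu hSu => ?_
    have hpt : ∀ F, Filter.Tendsto (fun k => ∑ j ∈ F, a (u k) j • x j) Filter.atTop
        (nhds (ψ F)) := by
      intro F
      rw [tendsto_iff_norm_sub_tendsto_zero] at hSu ⊢
      refine squeeze_zero (fun _ => norm_nonneg _) (fun k => ?_) hSu
      exact lp.norm_apply_le_norm ENNReal.top_ne_zero (S (u k) - ψ) F
    have hco : ∀ j, ∃ α : ℝ, Filter.Tendsto (fun k => a (u k) j) Filter.atTop (nhds α) := by
      intro j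
      refine cauchySeq_tendsto_of_complete ?_
      have h1 := (hpt {j}).cauchySeq
      simp only [Finset.sum_singleton] at h1
      rw [Metric.cauchySeq_iff] at h1 ⊢
      intro ε hε
      obtain ⟨N, hN⟩ := h1 ε hε
      refine ⟨N, fun m hm n hn => ?_⟩
      have := hN m hm n hn
      rwa [dist_eq_norm, ← sub_smul, norm_smul, hnorm, mul_one, ← dist_eq_norm] at this
    choose α hα using hco
    have hψ : ∀ F, ψ F = ∑ j ∈ F, α j • x j := fun F =>
      tendsto_nhds_unique (hpt F) (tendsto_finsetSum F fun j _ => (hα j).smul_const (x j))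
    have hαf : HasSum (fun j => α j • x j) f := by
      rw [HasSum, SummationFilter.unconditional_filter, Metric.tendsto_nhds]
      intro ε hε
      have e1 := (Metric.tendsto_nhds.1 hu) (ε / 3) (by positivity)
      have e2 := (Metric.tendsto_nhds.1 hSu) (ε / 3) (by positivity)
      obtain ⟨k, hk1, hk2⟩ := (e1.and e2).exists
      have e3 := ha (u k)
      rw [HasSum, SummationFilter.unconditional_filter] at e3
      filter_upwards [(Metric.tendsto_nhds.1 e3) (ε / 3) (by positivity)] with F hF
      have e4 : dist (∑ j ∈ F, a (u k) j • x j) (∑ j ∈ F, α j • x j) ≤ dist (S (u k)) ψ := by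
        rw [← hψ, dist_eq_norm, dist_eq_norm]
        exact lp.norm_apply_le_norm ENNReal.top_ne_zero (S (u k) - ψ) F
      have e5 := dist_triangle4 (∑ j ∈ F, α j • x j) (∑ j ∈ F, a (u k) j • x j) (u k) f
      rw [dist_comm] at e4
      change dist (S (u k)) ψ < ε / 3 at hk2
      linarith
    ext F
    rw [hψ, hS, huniq f α hαf]
  clear_value S
  let S' : X →L[ℝ] lp (fun _ : Finset J => X) ∞ := ⟨S, hScont⟩
  have hbd : ∀ (F : Finset J) f, ‖∑ j ∈ F, a f j • x j‖ ≤ max 1 ‖S'‖ * ‖f‖ := fun F f => by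
    rw [← hS]
    calc ‖(S f : ∀ _ : Finset J, X) F‖ ≤ ‖S f‖ := lp.norm_apply_le_norm ENNReal.top_ne_zero (S f) F
      _ ≤ ‖S'‖ * ‖f‖ := S'.le_opNorm f
      _ ≤ max 1 ‖S'‖ * ‖f‖ :=
        mul_le_mul_of_nonneg_right (le_max_right _ _) (norm_nonneg _)
  refine ⟨fun j => LinearMap.mkContinuous
    { toFun := fun f => a f j, map_add' := fun f g => by rw [hadd]; rfl,
      map_smul' := fun r f => by rw [hsmul]; rfl } (max 1 ‖S'‖) fun f => ?_,
    max 1 ‖S'‖, le_max_left _ _, ha, fun f b hb j => ?_, hbd⟩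
  · simpa [norm_smul, hnorm] using hbd {j} f
  · exact congrFun (huniq f b hb) j

lemma c0_norm_le {v : C₀(ℕ, ℝ)} {C : ℝ} (hC : 0 ≤ C) (h : ∀ n, |v n| ≤ C) : ‖v‖ ≤ C := by
  rw [← ZeroAtInftyContinuousMap.norm_toBCF_eq_norm]
  exact (BoundedContinuousFunction.norm_le hC).2 h

lemma c0_apply_le (v : C₀(ℕ, ℝ)) (n : ℕ) : |v n| ≤ ‖v‖ := by
  rw [← ZeroAtInftyContinuousMap.norm_toBCF_eq_norm]
  exact v.toBCF.norm_coe_le_norm n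

lemma c0single_apply (n k : ℕ) : c0single n k = if k = n then 1 else 0 := rfl

lemma c0_sum_apply (G : Finset ℕ) (t : ℕ → ℝ) (k : ℕ) :
    (∑ n ∈ G, t n • c0single n) k = if k ∈ G then t k else 0 := by
  classical
  induction G using Finset.induction_on with
  | empty => simp
  | insert i G hi ih =>
    rw [Finset.sum_insert hi, ZeroAtInftyContinuousMap.add_apply,
      ZeroAtInftyContinuousMap.smul_apply, ih, c0single_apply]
    by_cases h : k = i
    · subst h; simp [hi]
    · simp [h]

lemma c0_hasSum (v : C₀(ℕ, ℝ)) : HasSum (fun n => v n • c0single n) v := by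
  rw [HasSum, SummationFilter.unconditional_filter, Metric.tendsto_nhds]
  intro ε hε
  have h0 : Filter.Tendsto v Filter.cofinite (nhds 0) := by
    have := v.zero_at_infty'
    rwa [Filter.cocompact_eq_cofinite] at this
  have h1 := (Metric.tendsto_nhds.1 h0) (ε / 2) (by positivity)
  have h2 : {n | ¬ dist (v n) 0 < ε / 2}.Finite := h1
  filter_upwards [Filter.eventually_ge_atTop h2.toFinset] with F hF
  rw [dist_eq_norm]
  refine lt_of_le_of_lt (c0_norm_le (C := ε / 2) (by positivity) fun k => ?_) (by linarith)
  rw [ZeroAtInftyContinuousMap.sub_apply, c0_sum_apply]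
  by_cases hk : k ∈ F
  · simp [hk]; positivity
  · have : ¬ ¬ dist (v k) 0 < ε / 2 := fun h => hk (hF (by simpa using h))
    simp only [not_not, dist_zero_right, Real.norm_eq_abs] at this
    simpa [hk] using this.le

lemma l1_sum_le (p : lp (fun _ : ℕ => ℝ) 1) (G : Finset ℕ) : ∑ n ∈ G, |p n| ≤ ‖p‖ := by
  have := lp.sum_rpow_le_norm_rpow (p := 1) (by simp) p G
  simpa using this

lemma l1_norm_single (n : ℕ) (t : ℝ) : ‖(lp.single 1 n t : lp (fun _ : ℕ => ℝ) 1)‖ = |t| := by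
  simp

lemma l1_hasSum (p : lp (fun _ : ℕ => ℝ) 1) :
    HasSum (fun n => p n • (lp.single 1 n (1:ℝ) : lp (fun _ : ℕ => ℝ) 1)) p := by
  have := lp.hasSum_single (p := 1) (E := fun _ : ℕ => ℝ) (by simp) p
  convert this using 2 with n
  rw [← lp.single_smul, smul_eq_mul, mul_one]

abbrev LC := (lp (fun _ : ℕ => ℝ) 1) × C₀(ℕ, ℝ)

section generic
variable {X : Type*} [NormedAddCommGroup X] [NormedSpace ℝ X] {J : Type*}

/-- A family with coordinate functionals and unconditional constant `K`. -/
structure UB (x : J → X) (φ : J → X →L[ℝ] ℝ) (K : ℝ) : Prop where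
  nrm : ∀ j, ‖x j‖ = 1
  one_le : 1 ≤ K
  hsum : ∀ f, HasSum (fun j => φ j f • x j) f
  uniq : ∀ (f : X) (a : J → ℝ), HasSum (fun j => a j • x j) f → ∀ j, a j = φ j f
  bd : ∀ (F : Finset J) f, ‖∑ j ∈ F, φ j f • x j‖ ≤ K * ‖f‖

variable {x : J → X} {φ : J → X →L[ℝ] ℝ} {K : ℝ}

open Classical in
lemma UB.coord_sum (h : UB x φ K) (F : Finset J) (c : J → ℝ) (i : J) :
    φ i (∑ j ∈ F, c j • x j) = if i ∈ F then c i else 0 := by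
  refine (h.uniq _ (fun i => if i ∈ F then c i else 0) ?_ i).symm
  have : HasSum (fun j => (if j ∈ F then c j else 0) • x j)
      (∑ j ∈ F, (if j ∈ F then c j else 0) • x j) :=
    hasSum_sum_of_ne_finset_zero (fun j hj => by simp [hj])
  convert this using 1
  exact Finset.sum_congr rfl fun j hj => by simp [hj]

open Classical in
lemma UB.biorth (h : UB x φ K) (i j : J) : φ i (x j) = if i = j then 1 else 0 := by
  have := h.coord_sum {j} (fun _ => 1) i
  simpa using this

lemma UB.coord_le (h : UB x φ K) (j : J) (f : X) : |φ j f| ≤ K * ‖f‖ := by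
  have := h.bd {j} f
  simpa [norm_smul, h.nrm] using this

lemma UB.sign_bd (h : UB x φ K) (F s : Finset J) (f : X) :
    ‖∑ j ∈ F, (sgnOf s j * φ j f) • x j‖ ≤ 2 * K * ‖f‖ := by
  classical
  have e : ∑ j ∈ F, (sgnOf s j * φ j f) • x j =
      ∑ j ∈ F ∩ s, φ j f • x j - ∑ j ∈ F \ s, φ j f • x j := by
    rw [← Finset.sum_inter_add_sum_sdiff F s, sub_eq_add_neg, ← Finset.sum_neg_distrib]
    congr 1
    · refine Finset.sum_congr rfl fun j hj => ?_
      simp [sgnOf, (Finset.mem_inter.1 hj).2]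
    · refine Finset.sum_congr rfl fun j hj => ?_
      simp [sgnOf, (Finset.mem_sdiff.1 hj).2]
  rw [e]
  have := norm_sub_le (∑ j ∈ F ∩ s, φ j f • x j) (∑ j ∈ F \ s, φ j f • x j)
  have := h.bd (F ∩ s) f
  have := h.bd (F \ s) f
  linarith

lemma UB.sign_bd' (h : UB x φ K) (F s : Finset J) (c : J → ℝ) :
    ‖∑ j ∈ F, (sgnOf s j * c j) • x j‖ ≤ 2 * K * ‖∑ j ∈ F, c j • x j‖ := by
  classical
  have := h.sign_bd F s (∑ j ∈ F, c j • x j)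
  convert this using 2
  refine Finset.sum_congr rfl fun j hj => ?_
  rw [h.coord_sum, if_pos hj]

lemma UB.dual_bd (h : UB x φ K) (F : Finset J) (g : X →L[ℝ] ℝ) :
    ‖∑ j ∈ F, g (x j) • φ j‖ ≤ K * ‖g‖ := by
  have := h.one_le
  refine ContinuousLinearMap.opNorm_le_bound _ (by positivity) fun f => ?_
  have e : (∑ j ∈ F, g (x j) • φ j) f = g (∑ j ∈ F, φ j f • x j) := by
    simp [sum_apply, mul_comm]
  rw [e]
  calc _ ≤ ‖g‖ * ‖∑ j ∈ F, φ j f • x j‖ := g.le_opNorm _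
    _ ≤ ‖g‖ * (K * ‖f‖) := by gcongr; exact h.bd F f
    _ = _ := by ring

lemma UB.dual_sign_bd (h : UB x φ K) (F s : Finset J) (c : J → ℝ) :
    ‖∑ j ∈ F, (sgnOf s j * c j) • φ j‖ ≤ 2 * K * ‖∑ j ∈ F, c j • φ j‖ := by
  classical
  have := h.one_le
  refine ContinuousLinearMap.opNorm_le_bound _ (by positivity) fun f => ?_
  set g := ∑ j ∈ F, c j • φ j with hg
  have hgx : ∀ j ∈ F, g (x j) = c j := by
    intro j hj
    simp [hg, sum_apply, h.biorth, hj]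
  have e : (∑ j ∈ F, (sgnOf s j * c j) • φ j) f = g (∑ j ∈ F, (sgnOf s j * φ j f) • x j) := by
    rw [map_sum, sum_apply]
    refine Finset.sum_congr rfl fun j hj => ?_
    simp only [map_smul, smul_apply, smul_eq_mul, hgx j hj]
    ring
  rw [e]
  calc _ ≤ ‖g‖ * ‖∑ j ∈ F, (sgnOf s j * φ j f) • x j‖ := g.le_opNorm _
    _ ≤ ‖g‖ * (2 * K * ‖f‖) := by gcongr; exact h.sign_bd F s f
    _ = _ := by ring

/-- `φ_j f` paired with a functional. -/
lemma UB.hasSum_apply (h : UB x φ K) (g : X →L[ℝ] ℝ) (f : X) :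
    HasSum (fun j => φ j f * g (x j)) (g f) := by
  have := g.hasSum (h.hsum f)
  simpa using this

lemma UB.exists_sum (h : UB x φ K) (g : X →L[ℝ] ℝ) (f : X) (hgf : g f = 1) :
    ∃ F : Finset J, 1 / 2 ≤ ∑ j ∈ F, |φ j f * g (x j)| := by
  have h1 := h.hasSum_apply g f
  rw [hgf, HasSum, SummationFilter.unconditional_filter] at h1
  obtain ⟨F, hF⟩ := (h1.eventually (lt_mem_nhds (show (1:ℝ) / 2 < 1 by norm_num))).exists
  exact ⟨F, hF.le.trans (Finset.sum_le_sum fun _ _ => le_abs_self _)⟩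
end generic

/-- coordinates -/
def l1c (n : ℕ) : LC →L[ℝ] ℝ :=
  LinearMap.mkContinuous
    { toFun := fun f => f.1 n, map_add' := fun _ _ => rfl, map_smul' := fun _ _ => rfl } 1
    fun f => by
      have h := l1_sum_le f.1 {n}
      have h2 := norm_fst_le f
      simp only [Finset.sum_singleton] at h
      rw [one_mul]
      exact h.trans h2

def c0c (n : ℕ) : LC →L[ℝ] ℝ :=
  LinearMap.mkContinuous
    { toFun := fun f => f.2 n, map_add' := fun _ _ => rfl, map_smul' := fun _ _ => rfl } 1
    fun f => by simpa using (c0_apply_le f.2 n).trans (norm_snd_le f)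

lemma l1c_apply (n : ℕ) (f : LC) : l1c n f = f.1 n := rfl
lemma c0c_apply (n : ℕ) (f : LC) : c0c n f = f.2 n := rfl
lemma c0c_le (n : ℕ) (f : LC) : |c0c n f| ≤ ‖f‖ :=
  (c0_apply_le f.2 n).trans (norm_snd_le f)
lemma c0c_norm (n : ℕ) : ‖c0c n‖ ≤ 1 := LinearMap.mkContinuous_norm_le _ zero_le_one _

def eL (n : ℕ) : LC := (lp.single 1 n (1:ℝ), 0)
def eC (n : ℕ) : LC := (0, c0single n)

lemma eL_norm (n : ℕ) : ‖eL n‖ = 1 := by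
  rw [eL, Prod.norm_def, l1_norm_single]; simp
lemma l1c_eL (n : ℕ) : l1c n (eL n) = 1 := by simp [l1c_apply, eL]
lemma c0c_eC (n : ℕ) : c0c n (eC n) = 1 := by simp [c0c_apply, eC, c0single_apply]

lemma eC_sum (G : Finset ℕ) (t : ℕ → ℝ) (ht : ∀ n, |t n| ≤ 1) : ‖∑ n ∈ G, t n • eC n‖ ≤ 1 := by
  have e : ∑ n ∈ G, t n • eC n = (0, ∑ n ∈ G, t n • c0single n) := by
    ext1
    · rw [Prod.fst_sum]; simp [eC]
    · rw [Prod.snd_sum]; simp [eC]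
  rw [e, Prod.norm_def]
  refine max_le (by simp) (c0_norm_le zero_le_one fun k => ?_)
  rw [c0_sum_apply]
  split_ifs
  · exact ht k
  · simp

lemma eL_hasSum (g : LC →L[ℝ] ℝ) (f : LC) :
    HasSum (fun n => l1c n f * g (eL n)) (g (f.1, 0)) := by
  have := (g.comp (ContinuousLinearMap.inl ℝ _ _)).hasSum (l1_hasSum f.1)
  simpa [l1c_apply, eL] using this

lemma eC_hasSum (g : LC →L[ℝ] ℝ) (f : LC) :
    HasSum (fun n => c0c n f * g (eC n)) (g (0, f.2)) := by
  have := (g.comp (ContinuousLinearMap.inr ℝ _ _)).hasSum (c0_hasSum f.2)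
  simpa [c0c_apply, eC] using this

lemma sgn_abs {ι : Type*} (s : Finset ι) (j : ι) : |sgnOf s j| = 1 := by
  unfold sgnOf; split_ifs <;> simp

lemma split_apply (g : LC →L[ℝ] ℝ) (f : LC) : g (f.1, 0) + g (0, f.2) = g f := by
  rw [← map_add]; simp

lemma exists_G {J : Type*} (F : Finset J) (m : J → ℕ → ℝ) (t : J → ℝ)
    (h : ∀ j ∈ F, HasSum (m j) (t j)) (ht : ∀ j ∈ F, 1 / 3 < t j) :
    ∃ G : Finset ℕ, ∀ j ∈ F, 1 / 3 ≤ ∑ n ∈ G, m j n := by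
  have : ∀ᶠ G : Finset ℕ in Filter.atTop, ∀ j ∈ F, 1 / 3 < ∑ n ∈ G, m j n := by
    rw [Filter.eventually_all_finset]
    intro j hj
    have := h j hj
    rw [HasSum, SummationFilter.unconditional_filter] at this
    exact this.eventually (lt_mem_nhds (ht j hj))
  obtain ⟨G, hG⟩ := this.exists
  exact ⟨G, fun j hj => (hG j hj).le⟩

lemma lemA {J : Type*} {x : J → LC} {φ : J → LC →L[ℝ] ℝ} {K : ℝ} (h : UB x φ K) (F : Finset J)
    (hF : ∀ j ∈ F, 1 / 3 < φ j ((x j).1, 0)) (f : LC) :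
    ∑ j ∈ F, |φ j f| ≤ 288 * K ^ 6 * ‖f‖ := by
  have hK := h.one_le
  obtain ⟨G, hG⟩ := exists_G F (fun j n => l1c n (x j) * φ j (eL n)) _
    (fun j _ => eL_hasSum (φ j) (x j)) hF
  have := key_estimate F G (fun j n => l1c n (x j)) (fun j n => φ j (eL n))
    (fun c => 2 * K * ‖∑ j ∈ F, c j • x j‖) (2 * K ^ 2) (by positivity) ?_ ?_ ?_ hG
    (fun j => φ j f)
  · refine this.trans ?_
    have h2 := h.bd F f
    calc 36 * (2 * K ^ 2) ^ 2 * (2 * K * ‖∑ j ∈ F, φ j f • x j‖)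
        ≤ 36 * (2 * K ^ 2) ^ 2 * (2 * K * (K * ‖f‖)) := by gcongr
      _ = _ := by ring
  · intro c s _
    refine le_trans ?_ (h.sign_bd' F s c)
    refine le_trans ?_ (norm_fst_le _)
    refine le_trans (le_of_eq ?_) (l1_sum_le _ G)
    refine Finset.sum_congr rfl fun n _ => ?_
    rw [← l1c_apply, map_sum]
    simp [mul_assoc]
  · intro n _
    have := h.bd F (eL n)
    rw [eL_norm, mul_one] at this
    calc 2 * K * ‖∑ j ∈ F, φ j (eL n) • x j‖ ≤ 2 * K * K := by gcongr
      _ = _ := by ring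
  · intro j _ n _
    have := h.coord_le j (eL n)
    rw [eL_norm] at this
    nlinarith

lemma sum_eC_le (g : LC →L[ℝ] ℝ) (G : Finset ℕ) : ∑ n ∈ G, |g (eC n)| ≤ ‖g‖ := by
  classical
  set t : ℕ → ℝ := fun n => if 0 ≤ g (eC n) then 1 else -1 with ht
  have e : ∑ n ∈ G, |g (eC n)| = g (∑ n ∈ G, t n • eC n) := by
    rw [map_sum]
    refine Finset.sum_congr rfl fun n _ => ?_
    rw [map_smul, smul_eq_mul]
    simp only [ht]
    split_ifs with h0
    · rw [abs_of_nonneg h0, one_mul]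
    · rw [abs_of_neg (not_le.1 h0)]; ring
  rw [e]
  calc _ ≤ ‖g (∑ n ∈ G, t n • eC n)‖ := le_abs_self _
    _ ≤ ‖g‖ * ‖∑ n ∈ G, t n • eC n‖ := g.le_opNorm _
    _ ≤ ‖g‖ * 1 := by
      gcongr
      refine eC_sum G t fun n => ?_
      simp only [ht]; split_ifs <;> simp
    _ = _ := mul_one _

lemma lemB {J : Type*} {x : J → LC} {φ : J → LC →L[ℝ] ℝ} {K : ℝ} (h : UB x φ K) (F : Finset J)
    (hF : ∀ j ∈ F, 1 / 3 < φ j (0, (x j).2)) (g : LC →L[ℝ] ℝ) :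
    ∑ j ∈ F, |g (x j)| ≤ 288 * K ^ 6 * ‖g‖ := by
  have hK := h.one_le
  obtain ⟨G, hG⟩ := exists_G F (fun j n => c0c n (x j) * φ j (eC n)) _
    (fun j _ => eC_hasSum (φ j) (x j)) hF
  have := key_estimate F G (fun j n => φ j (eC n)) (fun j n => c0c n (x j))
    (fun c => 2 * K * ‖∑ j ∈ F, c j • φ j‖) (2 * K ^ 2) (by positivity) ?_ ?_ ?_
    (fun j hj => by simpa only [mul_comm] using hG j hj)
    (fun j => g (x j))
  · refine this.trans ?_
    have h2 := h.dual_bd F g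
    calc 36 * (2 * K ^ 2) ^ 2 * (2 * K * ‖∑ j ∈ F, g (x j) • φ j‖)
        ≤ 36 * (2 * K ^ 2) ^ 2 * (2 * K * (K * ‖g‖)) := by gcongr
      _ = _ := by ring
  · intro c s _
    refine le_trans ?_ (h.dual_sign_bd F s c)
    refine le_trans (le_of_eq ?_) (sum_eC_le _ G)
    refine Finset.sum_congr rfl fun n _ => ?_
    simp [sum_apply, mul_assoc]
  · intro n _
    have h2 := h.dual_bd F (c0c n)
    have h3 := c0c_norm n
    calc 2 * K * ‖∑ j ∈ F, c0c n (x j) • φ j‖ ≤ 2 * K * (K * 1) := by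
          gcongr
          exact h2.trans (by gcongr)
      _ = _ := by ring
  · intro j _ n _
    have := c0c_le n (x j)
    rw [h.nrm] at this
    nlinarith

lemma sum_split {J : Type*} (S : Set J) (hS : S.Finite) (F : Finset J) (a : J → ℝ) (C D : ℝ)
    (hD : ∀ j, |a j| ≤ D) (hC : ∀ F : Finset J, (∀ j ∈ F, j ∉ S) → ∑ j ∈ F, |a j| ≤ C) :
    ∑ j ∈ F, |a j| ≤ hS.toFinset.card * D + C := by
  classical
  rw [← Finset.sum_inter_add_sum_sdiff F hS.toFinset]
  refine add_le_add ?_ (hC _ fun j hj => by simpa using (Finset.mem_sdiff.1 hj).2)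
  calc _ ≤ ∑ j ∈ hS.toFinset, |a j| :=
        Finset.sum_le_sum_of_subset_of_nonneg Finset.inter_subset_right fun _ _ _ => abs_nonneg _
    _ ≤ ∑ j ∈ hS.toFinset, D := Finset.sum_le_sum fun j _ => hD j
    _ = _ := by simp

lemma infinite_A {J : Type*} {x : J → LC} {φ : J → LC →L[ℝ] ℝ} {K : ℝ} (h : UB x φ K)
    (S : Set J) (hB : ∀ j ∉ S, 1 / 3 < φ j (0, (x j).2)) : S.Infinite := by
  intro hS
  have hK := h.one_le
  refine no_c0_in_l1 (fun n j => l1c n (x j)) (hS.toFinset.card * 1 + 288 * K ^ 6) (1 / (2 * K))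
    (by positivity) (fun F G s _ => ?_) fun n => ?_
  · set g : LC →L[ℝ] ℝ := ∑ n ∈ G, sgnOf s n • l1c n with hg
    have hgn : ‖g‖ ≤ 1 := by
      refine ContinuousLinearMap.opNorm_le_bound _ zero_le_one fun f => ?_
      rw [one_mul]
      refine le_trans ?_ ((l1_sum_le f.1 G).trans (norm_fst_le f))
      rw [hg, sum_apply]
      refine (norm_sum_le _ _).trans (le_of_eq (Finset.sum_congr rfl fun n _ => ?_))
      simp [sgn_abs, l1c_apply]
    have e : ∀ j, ∑ n ∈ G, sgnOf s n * l1c n (x j) = g (x j) := fun j => by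
      simp [hg, sum_apply]
    simp only [e]
    refine sum_split S hS F _ _ _ (fun j => ?_) fun F hF => ?_
    · have := g.le_opNorm (x j)
      rw [h.nrm, mul_one] at this
      exact this.trans hgn
    · refine (lemB h F (fun j hj => hB j (hF j hj)) g).trans ?_
      exact mul_le_of_le_one_right (by positivity) hgn
  · obtain ⟨F, hF⟩ := h.exists_sum (l1c n) (eL n) (l1c_eL n)
    refine ⟨F, ?_⟩
    have : ∑ j ∈ F, |φ j (eL n) * l1c n (x j)| ≤ K * ∑ j ∈ F, |l1c n (x j)| := by
      rw [Finset.mul_sum]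
      refine Finset.sum_le_sum fun j _ => ?_
      rw [abs_mul]
      have := h.coord_le j (eL n)
      rw [eL_norm, mul_one] at this
      gcongr
    rw [div_le_iff₀ (by positivity)]
    linarith

lemma infinite_B {J : Type*} {x : J → LC} {φ : J → LC →L[ℝ] ℝ} {K : ℝ} (h : UB x φ K)
    (S : Set J) (hA : ∀ j ∉ S, 1 / 3 < φ j ((x j).1, 0)) : S.Infinite := by
  intro hS
  have hK := h.one_le
  refine no_c0_in_l1 (fun n j => φ j (eC n)) (hS.toFinset.card * K + 288 * K ^ 6) (1 / 2)
    (by positivity) (fun F G s _ => ?_) fun n => ?_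
  · set f : LC := ∑ n ∈ G, sgnOf s n • eC n with hf
    have hfn : ‖f‖ ≤ 1 := eC_sum G _ fun n => (sgn_abs s n).le
    have e : ∀ j, ∑ n ∈ G, sgnOf s n * φ j (eC n) = φ j f := fun j => by
      simp [hf, map_sum]
    simp only [e]
    refine sum_split S hS F _ _ _ (fun j => ?_) fun F hF => ?_
    · exact (h.coord_le j f).trans (mul_le_of_le_one_right (by positivity) hfn)
    · refine (lemA h F (fun j hj => hA j (hF j hj)) f).trans ?_
      exact mul_le_of_le_one_right (by positivity) hfn
  · obtain ⟨F, hF⟩ := h.exists_sum (c0c n) (eC n) (c0c_eC n)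
    refine ⟨F, hF.trans (Finset.sum_le_sum fun j _ => ?_)⟩
    rw [abs_mul]
    have := c0c_le n (x j)
    rw [h.nrm] at this
    exact mul_le_of_le_one_right (abs_nonneg _) this

lemma UB.countable {J : Type*} {x : J → LC} {φ : J → LC →L[ℝ] ℝ} {K : ℝ} (h : UB x φ K) :
    Countable J := by
  have hs : ∀ f : LC, {j | φ j f ≠ 0}.Countable := by
    intro f
    refine (h.hsum f).summable.countable_support.mono fun j hj => ?_
    have : x j ≠ 0 := fun h0 => by have := h.nrm j; simp [h0] at this
    simpa [this] using hj
  have hu : ((⋃ n, {j | φ j (eL n) ≠ 0}) ∪ ⋃ n, {j | φ j (eC n) ≠ 0}).Countable :=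
    (Set.countable_iUnion fun n => hs _).union (Set.countable_iUnion fun n => hs _)
  rw [← Set.countable_univ_iff]
  refine hu.mono fun j _ => ?_
  by_contra hj
  simp only [Set.mem_union, Set.mem_iUnion, Set.mem_ofPred_eq, not_or, not_exists, not_not] at hj
  have h1 := eL_hasSum (φ j) (x j)
  have h2 := eC_hasSum (φ j) (x j)
  simp only [hj.1, hj.2, mul_zero] at h1 h2
  have h3 := split_apply (φ j) (x j)
  rw [h1.unique hasSum_zero, h2.unique hasSum_zero, h.biorth, if_pos rfl] at h3
  norm_num at h3

lemma upper_B {J : Type*} {x : J → LC} {φ : J → LC →L[ℝ] ℝ} {K : ℝ} (h : UB x φ K) (F : Finset J)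
    (hF : ∀ j ∈ F, 1 / 3 < φ j (0, (x j).2)) (c : J → ℝ) (η : ℝ) (hη : 0 ≤ η)
    (hc : ∀ j ∈ F, |c j| ≤ η) :
    ‖∑ j ∈ F, c j • x j‖ ≤ 288 * K ^ 6 * η := by
  have hK := h.one_le
  obtain ⟨g, hg1, hg2⟩ := exists_dual_vector'' ℝ (∑ j ∈ F, c j • x j)
  have e : ‖∑ j ∈ F, c j • x j‖ = g (∑ j ∈ F, c j • x j) := by simpa using hg2.symm
  rw [e, map_sum]
  calc ∑ j ∈ F, g (c j • x j) ≤ ∑ j ∈ F, η * |g (x j)| := by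
        refine Finset.sum_le_sum fun j hj => ?_
        rw [map_smul, smul_eq_mul]
        refine (le_abs_self _).trans ?_
        rw [abs_mul]
        have := hc j hj
        gcongr
    _ = η * ∑ j ∈ F, |g (x j)| := (Finset.mul_sum _ _ _).symm
    _ ≤ η * (288 * K ^ 6 * 1) := by
        gcongr
        exact (lemB h F hF g).trans (by gcongr)
    _ = _ := by ring
lemma can_inl (n : ℕ) : canBasisL1C0 (Sum.inl n) = eL n := rfl
lemma can_inr (n : ℕ) : canBasisL1C0 (Sum.inr n) = eC n := rfl

lemma closedSpan_eq_top {X : Type*} [NormedAddCommGroup X] [NormedSpace ℝ X] {J : Type*}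
    (x : J → X) (h : ∀ f, ∃ a : J → ℝ, HasSum (fun j => a j • x j) f) : closedSpan x = ⊤ := by
  rw [eq_top_iff]
  intro f _
  obtain ⟨a, ha⟩ := h f
  refine (Submodule.isClosed_topologicalClosure _).mem_of_tendsto ha
    (Filter.Eventually.of_forall fun F => ?_)
  exact Submodule.sum_mem _ fun j _ => Submodule.smul_mem _ _ (mem_closedSpan x j)

lemma main_aux {J : Type*} {x : J → LC} {φ : J → LC →L[ℝ] ℝ} {K : ℝ} (h : UB x φ K)
    (S : Set J) (hA : ∀ j ∈ S, 1 / 3 < φ j ((x j).1, 0))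
    (hB : ∀ j ∉ S, 1 / 3 < φ j (0, (x j).2)) (eA : S ≃ ℕ) (eB : (Sᶜ : Set J) ≃ ℕ) :
    PermutativelyEquivalent x canBasisL1C0 := by
  classical
  have hK := h.one_le
  set C := 288 * K ^ 6 with hC
  have hC0 : 0 ≤ C := by positivity
  let α : ℕ → J := fun n => (eA.symm n : J)
  let β : ℕ → J := fun n => (eB.symm n : J)
  have hαS : ∀ n, α n ∈ S := fun n => (eA.symm n).2
  have hβS : ∀ n, β n ∉ S := fun n => (eB.symm n).2
  have hαi : Function.Injective α := Subtype.val_injective.comp eA.symm.injective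
  have hβi : Function.Injective β := Subtype.val_injective.comp eB.symm.injective
  let π : J ≃ ℕ ⊕ ℕ := (Equiv.Set.sumCompl S).symm.trans (Equiv.sumCongr eA eB)
  have hπl : ∀ n, π.symm (Sum.inl n) = α n := fun n => rfl
  have hπr : ∀ n, π.symm (Sum.inr n) = β n := fun n => rfl
  have hT1 : ∀ (f : LC) (G : Finset ℕ), ∑ n ∈ G, |φ (α n) f| ≤ C * ‖f‖ := by
    intro f G
    have := lemA h (G.map ⟨α, hαi⟩) (fun j hj => by
      obtain ⟨n, _, rfl⟩ := Finset.mem_map.1 hj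
      exact hA _ (hαS n)) f
    simpa [Finset.sum_map] using this
  have hT2 : ∀ f : LC, Filter.Tendsto (fun n => φ (β n) f) (Filter.cocompact ℕ) (nhds 0) := by
    intro f
    rw [Filter.cocompact_eq_cofinite]
    have h1 : Filter.Tendsto (fun j => φ j f • x j) Filter.cofinite (nhds 0) :=
      (h.hsum f).summable.tendsto_cofinite_zero
    have h2 : Filter.Tendsto (fun j => φ j f) Filter.cofinite (nhds 0) := by
      rw [tendsto_zero_iff_norm_tendsto_zero] at h1 ⊢
      simpa [norm_smul, h.nrm] using h1
    exact h2.comp hβi.tendsto_cofinite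
  let T1 : LC → lp (fun _ : ℕ => ℝ) 1 := fun f => ⟨fun n => φ (α n) f, by
    refine memℓp_gen' (C := C * ‖f‖) fun G => ?_
    simpa using hT1 f G⟩
  let T2 : LC → C₀(ℕ, ℝ) := fun f =>
    ⟨⟨fun n => φ (β n) f, continuous_of_discreteTopology⟩, hT2 f⟩
  have hT1a : ∀ f n, T1 f n = φ (α n) f := fun _ _ => rfl
  have hT2a : ∀ f n, T2 f n = φ (β n) f := fun _ _ => rfl
  have hT1n : ∀ f, ‖T1 f‖ ≤ C * ‖f‖ := fun f => by
    refine lp.norm_le_of_forall_sum_le (by simp) (by positivity) fun G => ?_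
    simpa using hT1 f G
  have hT2n : ∀ f, ‖T2 f‖ ≤ K * ‖f‖ := fun f =>
    c0_norm_le (by positivity) fun n => h.coord_le (β n) f
  let T0 : LC →ₗ[ℝ] LC :=
    { toFun := fun f => (T1 f, T2 f)
      map_add' := fun f g => by
        refine Prod.ext (lp.ext (funext fun n => ?_)) (ZeroAtInftyContinuousMap.ext fun n => ?_)
        · exact map_add (φ (α n)) f g
        · exact map_add (φ (β n)) f g
      map_smul' := fun r f => by
        refine Prod.ext (lp.ext (funext fun n => ?_)) (ZeroAtInftyContinuousMap.ext fun n => ?_)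
        · exact map_smul (φ (α n)) r f
        · exact map_smul (φ (β n)) r f }
  let T : LC →L[ℝ] LC := T0.mkContinuous (max C K) fun f => by
    refine max_le ((hT1n f).trans ?_) ((hT2n f).trans ?_)
    · exact mul_le_mul_of_nonneg_right (le_max_left _ _) (norm_nonneg _)
    · exact mul_le_mul_of_nonneg_right (le_max_right _ _) (norm_nonneg _)
  have hT : ∀ f, T f = (T1 f, T2 f) := fun f => rfl
  have hinj : Function.Injective T := by
    rw [injective_iff_map_eq_zero]
    intro f hf
    rw [hT] at hf
    have h1 : T1 f = 0 := congrArg Prod.fst hf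
    have h2 : T2 f = 0 := congrArg Prod.snd hf
    have h3 : ∀ j, φ j f = 0 := by
      intro j
      obtain ⟨i, rfl⟩ := π.symm.surjective j
      rcases i with n | n
      · rw [hπl, ← hT1a, h1]; rfl
      · rw [hπr, ← hT2a, h2]; rfl
    have h4 := h.hsum f
    simp only [h3, zero_smul] at h4
    exact h4.unique hasSum_zero
  have hsurj : Function.Surjective T := by
    rintro ⟨p, q⟩
    have s1 : Summable (fun n => p n • x (α n)) := by
      refine Summable.of_norm ?_
      simp only [norm_smul, h.nrm, mul_one]
      exact summable_of_sum_le (fun _ => norm_nonneg _) (l1_sum_le p)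
    have s2 : Summable (fun n => q n • x (β n)) := by
      rw [summable_iff_vanishing_norm]
      intro ε hε
      have h0 : Filter.Tendsto q Filter.cofinite (nhds 0) := by
        have := q.zero_at_infty'
        rwa [Filter.cocompact_eq_cofinite] at this
      have hη : 0 < ε / (2 * (C + 1)) := by positivity
      have h1 := (Metric.tendsto_nhds.1 h0) _ hη
      have h2 : {n | ¬ dist (q n) 0 < ε / (2 * (C + 1))}.Finite := h1
      refine ⟨h2.toFinset, fun t ht => ?_⟩
      have hq : ∀ n ∈ t, |q n| ≤ ε / (2 * (C + 1)) := by
        intro n hn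
        have : n ∉ h2.toFinset := Finset.disjoint_left.1 ht hn
        simp only [Set.Finite.mem_toFinset, Set.mem_ofPred_eq, not_not, dist_zero_right,
          Real.norm_eq_abs] at this
        exact this.le
      have h3 := upper_B h (t.map ⟨β, hβi⟩) (fun j hj => by
        obtain ⟨n, _, rfl⟩ := Finset.mem_map.1 hj
        exact hB _ (hβS n)) (Function.extend β q 0) _ hη.le (fun j hj => by
        obtain ⟨n, hn, rfl⟩ := Finset.mem_map.1 hj
        have : Function.extend β q 0 (β n) = q n := hβi.extend_apply _ _ _
        simpa [this] using hq n hn)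
      have e : ∑ j ∈ t.map ⟨β, hβi⟩, Function.extend β q 0 j • x j = ∑ n ∈ t, q n • x (β n) := by
        rw [Finset.sum_map]
        refine Finset.sum_congr rfl fun n _ => ?_
        simp [hβi.extend_apply]
      rw [e, ← hC] at h3
      refine h3.trans_lt ?_
      rw [mul_div_assoc', div_lt_iff₀ (by positivity)]
      nlinarith
    have s3 : HasSum (fun i : ℕ ⊕ ℕ => Sum.elim (fun n => p n) (fun n => q n) i • x (π.symm i))
        (∑' n, p n • x (α n) + ∑' n, q n • x (β n)) :=
      HasSum.sum s1.hasSum s2.hasSum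
    have s4 := (π.hasSum_iff).2 s3
    have s5 := h.uniq _ (fun j => Sum.elim (fun n => p n) (fun n => q n) (π j))
      (by simpa [Function.comp_def] using s4)
    refine ⟨∑' n, p n • x (α n) + ∑' n, q n • x (β n), ?_⟩
    · rw [hT]
      refine Prod.ext (lp.ext (funext fun n => ?_)) (ZeroAtInftyContinuousMap.ext fun n => ?_)
      · have := s5 (α n)
        rw [← hπl, Equiv.apply_symm_apply] at this
        exact this.symm
      · have := s5 (β n)
        rw [← hπr, Equiv.apply_symm_apply] at this
        exact this.symm
  have hTx : ∀ j, T (x j) = canBasisL1C0 (π j) := by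
    intro j
    obtain ⟨i, rfl⟩ := π.symm.surjective j
    rw [Equiv.apply_symm_apply, hT]
    have hne : ∀ m n, α m ≠ β n := fun m n e => hβS n (e ▸ hαS m)
    rcases i with n | n
    · rw [hπl, can_inl]
      refine Prod.ext (lp.ext (funext fun k => ?_)) (ZeroAtInftyContinuousMap.ext fun k => ?_)
      · change φ (α k) (x (α n)) = (lp.single 1 n (1:ℝ) : lp (fun _ : ℕ => ℝ) 1) k
        rw [h.biorth, lp.single_apply]
        by_cases hk : k = n
        · subst hk; simp
        · simp [hk, hαi.ne hk]
      · change φ (β k) (x (α n)) = 0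
        rw [h.biorth, if_neg (hne _ _).symm]
    · rw [hπr, can_inr]
      refine Prod.ext (lp.ext (funext fun k => ?_)) (ZeroAtInftyContinuousMap.ext fun k => ?_)
      · change φ (α k) (x (β n)) = 0
        rw [h.biorth, if_neg (hne _ _)]
      · change φ (β k) (x (β n)) = c0single n k
        rw [h.biorth, c0single_apply]
        simp [hβi.eq_iff]
  let Te : LC ≃L[ℝ] LC := ContinuousLinearEquiv.ofBijective T
    (LinearMap.ker_eq_bot.2 hinj) (LinearMap.range_eq_top.2 hsurj)
  have hTe : ∀ f, Te f = T f := fun f => by simp [Te]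
  have hx : closedSpan x = ⊤ := closedSpan_eq_top x fun f => ⟨_, h.hsum f⟩
  have hy : closedSpan canBasisL1C0 = ⊤ := closedSpan_eq_top _ fun f => by
    obtain ⟨g, rfl⟩ := hsurj f
    refine ⟨fun i => φ (π.symm i) g, ?_⟩
    have h1 := T.hasSum (h.hsum g)
    simp only [map_smul, hTx] at h1
    rw [← π.hasSum_iff]
    simpa [Function.comp_def] using h1
  refine ⟨π, Te.ofSubmodules _ _ ?_, fun j => ?_⟩
  · rw [hx, hy, Submodule.map_top]
    exact LinearMap.range_eq_top.2 Te.surjective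
  · rw [ContinuousLinearEquiv.ofSubmodules_apply]
    exact (hTe _).trans (hTx j)

/-- Every normalized unconditional basis of `ℓ₁ ⊕ c₀` (product with the max
norm) is permutatively equivalent to the canonical basis of `ℓ₁ ⊕ c₀`. -/
theorem uniqueness_of_unconditional_basis_l1_c0
    {J : Type} (x : J → (lp (fun _ : ℕ => ℝ) 1) × C₀(ℕ, ℝ))
    (hnorm : ∀ j, ‖x j‖ = 1)
    (hbasis : ∀ f : (lp (fun _ : ℕ => ℝ) 1) × C₀(ℕ, ℝ),
      ∃! a : J → ℝ, HasSum (fun j => a j • x j) f) :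
    PermutativelyEquivalent x canBasisL1C0 := by
  obtain ⟨φ, K, hK, hs, hu, hb⟩ := basis_coords x hnorm hbasis
  have h : UB x φ K := ⟨hnorm, hK, hs, hu, hb⟩
  set S : Set J := {j | 1 / 3 < φ j ((x j).1, 0)} with hS
  have hA : ∀ j ∈ S, 1 / 3 < φ j ((x j).1, 0) := fun j hj => hj
  have hB : ∀ j ∉ S, 1 / 3 < φ j (0, (x j).2) := by
    intro j hj
    have h1 := split_apply (φ j) (x j)
    rw [h.biorth, if_pos rfl] at h1
    have h2 : φ j ((x j).1, 0) ≤ 1 / 3 := not_lt.1 hj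
    linarith
  have hc := h.countable
  have iA : Infinite S := (infinite_A h S hB).to_subtype
  have iB : Infinite (Sᶜ : Set J) :=
    (infinite_B h Sᶜ fun j hj => hA j (not_not.1 hj)).to_subtype
  obtain ⟨eA⟩ : Nonempty (S ≃ ℕ) := nonempty_equiv_of_countable
  obtain ⟨eB⟩ : Nonempty ((Sᶜ : Set J) ≃ ℕ) := nonempty_equiv_of_countable
  exact main_aux h S hA hB eA eB

end
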